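/- Estimate on the accumulated building block sums: let a, b ∈ ℕ with a, b ≥ 2, β ∈ (0,1), α > 0, C_start ≥ 1, C_z ≥ 0, and define λ_n := a^{(b^n)}, r_n := C_start (C_z² + 1) λ_0^β λ_n^{−β}, ℓ_n := λ_n^{−1}. Then for every n ≥ 1, 𝔖_{n−1,α} := Σ_{k=1}^{n−1} 4^{n−1−k} ℓ_k^{−α} r_{k−1}^{1/2} ≤ r_n^{1/2} a^{b^{n−1}(bβ/2 + α)} 4^n. -/

import Mathlib

/-- Frequency parameter `λ_n = a^(b^n)`. -/
noncomputable def lamPar (a b n : ℕ) : ℝ := (a : ℝ) ^ (b ^ n)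

/-- Concentration parameter `r_n = C_start (C_z² + 1) λ_0^β λ_n^{−β}`. -/
noncomputable def rPar (a b : ℕ) (βp Cstart Cz : ℝ) (n : ℕ) : ℝ :=
  Cstart * (Cz ^ 2 + 1) * lamPar a b 0 ^ βp * lamPar a b n ^ (-βp)

/-- Mollification parameter `ℓ_n = λ_n^{−1}`. -/
noncomputable def ellPar (a b n : ℕ) : ℝ := (lamPar a b n)⁻¹

/-- Accumulated building block sum `𝔖_{N,α} = Σ_{k=1}^{N} 4^{N−k} ℓ_k^{−α} r_{k−1}^{1/2}`. -/
noncomputable def SPar (a b : ℕ) (βp Cstart Cz α : ℝ) (N : ℕ) : ℝ :=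
  ∑ k ∈ Finset.Icc 1 N,
    (4 : ℝ) ^ (N - k) * ellPar a b k ^ (-α) * rPar a b βp Cstart Cz (k - 1) ^ ((1 : ℝ) / 2)

theorem lamPar_eq_rpow (a b n : ℕ) : lamPar a b n = (a : ℝ) ^ ((b : ℝ) ^ n) := by
  rw [lamPar, ← Real.rpow_natCast, Nat.cast_pow]

theorem one_le_lamPar {a : ℕ} (ha : 1 ≤ a) (b n : ℕ) : 1 ≤ lamPar a b n :=
  one_le_pow₀ (by exact_mod_cast ha)

theorem lamPar_mono {a b : ℕ} (ha : 1 ≤ a) (hb : 1 ≤ b) : Monotone (lamPar a b) :=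
  fun _ _ h => pow_le_pow_right₀ (by exact_mod_cast ha) (Nat.pow_le_pow_right hb h)

theorem sum_Icc_four_pow_sub (N : ℕ) :
    3 * ∑ k ∈ Finset.Icc 1 N, (4 : ℝ) ^ (N - k) + 1 = 4 ^ N := by
  induction N with
  | zero => simp
  | succ N ih =>
    have h : ∑ k ∈ Finset.Icc 1 N, (4 : ℝ) ^ (N + 1 - k) =
        4 * ∑ k ∈ Finset.Icc 1 N, (4 : ℝ) ^ (N - k) := by
      rw [Finset.mul_sum]
      refine Finset.sum_congr rfl fun k hk => ?_
      rw [Nat.sub_add_comm (Finset.mem_Icc.mp hk).2, pow_succ']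
    rw [Finset.sum_Icc_succ_top (by lia), h, pow_succ', ← ih, Nat.sub_self]
    ring

theorem rPar_rpow_half {a : ℕ} (ha : 1 ≤ a) (b : ℕ) (βp : ℝ) {Cstart : ℝ} (hCs : 0 ≤ Cstart)
    (Cz : ℝ) (n : ℕ) :
    rPar a b βp Cstart Cz n ^ ((1 : ℝ) / 2) =
      (Cstart * (Cz ^ 2 + 1) * lamPar a b 0 ^ βp) ^ ((1 : ℝ) / 2) *
        lamPar a b n ^ (-βp / 2) := by
  have h0 := zero_le_one.trans (one_le_lamPar ha b 0)
  have hn := zero_le_one.trans (one_le_lamPar ha b n)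
  rw [rPar, Real.mul_rpow (by positivity) (by positivity), ← Real.rpow_mul hn]
  ring_nf

/-- Estimate on the accumulated building block sums: for `a, b ≥ 2`, `β ∈ (0,1)`, `α > 0`,
`C_start ≥ 1`, `C_z ≥ 0` and every `n ≥ 1`,
`𝔖_{n−1,α} ≤ r_n^{1/2} a^{b^{n−1}(bβ/2 + α)} 4^n`. -/
theorem building_block_sum_estimate (a b : ℕ) (ha : 2 ≤ a) (hb : 2 ≤ b)
    (βp α Cstart Cz : ℝ) (hβ0 : 0 < βp) (hβ1 : βp < 1) (hα : 0 < α)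
    (hCs : 1 ≤ Cstart) (hCz : 0 ≤ Cz) (n : ℕ) (hn : 1 ≤ n) :
    SPar a b βp Cstart Cz α (n - 1) ≤
      rPar a b βp Cstart Cz n ^ ((1 : ℝ) / 2) *
        (a : ℝ) ^ ((b : ℝ) ^ (n - 1) * ((b : ℝ) * βp / 2 + α)) * 4 ^ n := by
  have ha1 : 1 ≤ a := by lia
  have ha0 : (0 : ℝ) < a := by exact_mod_cast ha1
  have hbase : 0 ≤ Cstart * (Cz ^ 2 + 1) * lamPar a b 0 ^ βp := by
    have := zero_le_one.trans (one_le_lamPar ha1 b 0)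
    positivity
  obtain ⟨N, rfl⟩ : ∃ N, n = N + 1 := ⟨n - 1, by lia⟩
  simp only [SPar, Nat.add_sub_cancel, rPar_rpow_half ha1 b βp (zero_le_one.trans hCs)]
  set K := (Cstart * (Cz ^ 2 + 1) * lamPar a b 0 ^ βp) ^ ((1 : ℝ) / 2)
  have hK : 0 ≤ K := Real.rpow_nonneg hbase _
  have hrhs : lamPar a b (N + 1) ^ (-βp / 2) *
      (a : ℝ) ^ ((b : ℝ) ^ N * ((b : ℝ) * βp / 2 + α)) = lamPar a b N ^ α := by
    rw [lamPar_eq_rpow, lamPar_eq_rpow, ← Real.rpow_mul ha0.le, ← Real.rpow_mul ha0.le,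
      ← Real.rpow_add ha0]
    ring_nf
  have hL : 0 ≤ lamPar a b N ^ α :=
    Real.rpow_nonneg (zero_le_one.trans (one_le_lamPar ha1 b N)) _
  have hterm : ∀ k ∈ Finset.Icc 1 N,
      (4 : ℝ) ^ (N - k) * ellPar a b k ^ (-α) * (K * lamPar a b (k - 1) ^ (-βp / 2)) ≤
        (4 : ℝ) ^ (N - k) * (K * lamPar a b N ^ α) := by
    intro k hk
    have hk0 := zero_le_one.trans (one_le_lamPar ha1 b k)
    have h1 : ellPar a b k ^ (-α) ≤ lamPar a b N ^ α := by
      rw [ellPar, Real.inv_rpow hk0, Real.rpow_neg hk0, inv_inv]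
      exact Real.rpow_le_rpow hk0 (lamPar_mono ha1 (by lia) (Finset.mem_Icc.mp hk).2) hα.le
    have h2 : lamPar a b (k - 1) ^ (-βp / 2) ≤ 1 :=
      Real.rpow_le_one_of_one_le_of_nonpos (one_le_lamPar ha1 b _) (by linarith)
    have h3 : 0 ≤ lamPar a b (k - 1) ^ (-βp / 2) :=
      Real.rpow_nonneg (zero_le_one.trans (one_le_lamPar ha1 b _)) _
    calc (4 : ℝ) ^ (N - k) * ellPar a b k ^ (-α) * (K * lamPar a b (k - 1) ^ (-βp / 2))
        ≤ (4 : ℝ) ^ (N - k) * lamPar a b N ^ α * (K * 1) := by gcongr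
      _ = (4 : ℝ) ^ (N - k) * (K * lamPar a b N ^ α) := by ring
  have hsum : ∑ k ∈ Finset.Icc 1 N, (4 : ℝ) ^ (N - k) ≤ 4 ^ (N + 1) := by
    have := sum_Icc_four_pow_sub N
    have : (0 : ℝ) < 4 ^ N := by positivity
    rw [pow_succ]
    linarith
  calc _ ≤ ∑ k ∈ Finset.Icc 1 N, (4 : ℝ) ^ (N - k) * (K * lamPar a b N ^ α) :=
        Finset.sum_le_sum hterm
    _ = (K * lamPar a b N ^ α) * ∑ k ∈ Finset.Icc 1 N, (4 : ℝ) ^ (N - k) := by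
        rw [← Finset.sum_mul, mul_comm]
    _ ≤ (K * lamPar a b N ^ α) * 4 ^ (N + 1) := by gcongr
    _ = _ := by rw [← hrhs]; ring
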